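/- Let H be an infinite-dimensional separable complex Hilbert space, let p, q ∈ [1,∞] with 1/p + 1/q = 1, let C ∈ B^p(H) and T ∈ B^q(H), and let (e_n)_{n∈ℕ} and (g_n)_{n∈ℕ} be arbitrary orthonormal bases of H. Then the sequence of sets W_{[C]^e_{2n}}([T]^g_{2n}) (the [C]^e_{2n}-numerical ranges of the 2n×2n matrices [T]^g_{2n}) converges in the Hausdorff metric to the closure of W_C(T). -/

import Mathlib

open Filter
open scoped InnerProductSpace ENNReal

/-- The rank-one operator `x ↦ ⟪f, x⟫ • g`. -/
noncomputable def rankOne {H : Type*} [NormedAddCommGroup H] [InnerProductSpace ℂ H]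
    (f g : H) : H →L[ℂ] H :=
  (innerSL ℂ f).smulRight g

/-- The `n`-th singular value (`0`-indexed) of an operator, defined as its distance (in
operator norm) to the operators of rank at most `n`; for compact operators this coincides with
the `(n+1)`-st coefficient of a Schmidt decomposition. -/
noncomputable def sv {H : Type*} [NormedAddCommGroup H] [InnerProductSpace ℂ H]
    (T : H →L[ℂ] H) (n : ℕ) : ℝ :=
  ⨅ (u : Fin n → H) (v : Fin n → H), ‖T - ∑ i, rankOne (u i) (v i)‖

/-- Membership in the `p`-th Schatten class `B^p(H)`, `p ∈ [1,∞]`:  compact and, if `p ≠ ∞`,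
`p`-summable singular values. -/
def MemSchatten {H : Type*} [NormedAddCommGroup H] [InnerProductSpace ℂ H]
    (p : ℝ≥0∞) (T : H →L[ℂ] H) : Prop :=
  IsCompactOperator T ∧ (p ≠ ∞ → Summable fun n => sv T n ^ p.toReal)

/-- The Schatten `p`-norm `ν_p`. -/
noncomputable def schattenNorm {H : Type*} [NormedAddCommGroup H] [InnerProductSpace ℂ H]
    (p : ℝ≥0∞) (T : H →L[ℂ] H) : ℝ :=
  if p = ∞ then ‖T‖ else (∑' n, sv T n ^ p.toReal) ^ (1 / p.toReal)

/-- The trace of an operator computed along the orthonormal basis `b`; for trace-class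
operators this is basis-independent. -/
noncomputable def traceAlong {H : Type*} [NormedAddCommGroup H] [InnerProductSpace ℂ H]
    [CompleteSpace H] (b : HilbertBasis ℕ ℂ H) (A : H →L[ℂ] H) : ℂ :=
  ∑' i, ⟪(b i : H), A (b i)⟫_ℂ

/-- The `C`-numerical range `W_C(T) = { tr(C U† T U) | U unitary }`. -/
def cNumRange {H : Type*} [NormedAddCommGroup H] [InnerProductSpace ℂ H]
    [CompleteSpace H] (b : HilbertBasis ℕ ℂ H) (C T : H →L[ℂ] H) : Set ℂ :=
  {z | ∃ U ∈ unitary (H →L[ℂ] H), z = traceAlong b (C * star U * T * U)}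

/-- The upper-left `m × m` corner of (the matrix representation of) `A` with respect to the
orthonormal basis `e`. -/
noncomputable def cutOut {H : Type*} [NormedAddCommGroup H] [InnerProductSpace ℂ H]
    [CompleteSpace H] (e : HilbertBasis ℕ ℂ H) (m : ℕ) (A : H →L[ℂ] H) :
    Matrix (Fin m) (Fin m) ℂ :=
  Matrix.of fun i j => ⟪(e (i : ℕ) : H), A (e (j : ℕ))⟫_ℂ

/-- The `C₀`-numerical range of a matrix `T₀`. -/
def matNumRange {m : ℕ} (C₀ T₀ : Matrix (Fin m) (Fin m) ℂ) : Set ℂ :=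
  {z | ∃ U ∈ Matrix.unitaryGroup (Fin m) ℂ, z = Matrix.trace (C₀ * star U * T₀ * U)}


section CNR
variable {H : Type*} [NormedAddCommGroup H] [InnerProductSpace ℂ H]

def FR (n : ℕ) (A : H →L[ℂ] H) : Prop :=
  ∃ u v : Fin n → H, A = ∑ i, rankOne (u i) (v i)

lemma rankOne_apply' (f g x : H) : rankOne f g x = ⟪f, x⟫_ℂ • g := by
  simp [rankOne]

lemma FR.zero (n : ℕ) : FR n (0 : H →L[ℂ] H) := by
  refine ⟨fun _ => 0, fun _ => 0, ?_⟩
  ext x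
  simp [rankOne_apply']

lemma FR.add {m n : ℕ} {A B : H →L[ℂ] H} (hA : FR m A) (hB : FR n B) : FR (m + n) (A + B) := by
  obtain ⟨u, v, rfl⟩ := hA
  obtain ⟨u', v', rfl⟩ := hB
  refine ⟨Fin.append u u', Fin.append v v', ?_⟩
  rw [Fin.sum_univ_add]
  simp

lemma FR.mono {m n : ℕ} (h : m ≤ n) {A : H →L[ℂ] H} (hA : FR m A) : FR n A := by
  obtain ⟨k, rfl⟩ := Nat.exists_eq_add_of_le h
  simpa using hA.add (FR.zero k)

lemma FR.neg {n : ℕ} {A : H →L[ℂ] H} (hA : FR n A) : FR n (-A) := by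
  obtain ⟨u, v, rfl⟩ := hA
  refine ⟨u, fun i => - v i, ?_⟩
  ext x
  simp [rankOne_apply']

lemma FR.sub {m n : ℕ} {A B : H →L[ℂ] H} (hA : FR m A) (hB : FR n B) : FR (m + n) (A - B) := by
  rw [sub_eq_add_neg]; exact hA.add hB.neg

lemma FR.mul_left {n : ℕ} {A : H →L[ℂ] H} (hA : FR n A) (X : H →L[ℂ] H) : FR n (X * A) := by
  obtain ⟨u, v, rfl⟩ := hA
  refine ⟨u, fun i => X (v i), ?_⟩
  ext x
  simp [rankOne_apply']

lemma sv_bdd (T : H →L[ℂ] H) (n : ℕ) (u : Fin n → H) :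
    BddBelow (Set.range fun v : Fin n → H => ‖T - ∑ i, rankOne (u i) (v i)‖) :=
  ⟨0, by rintro _ ⟨v, rfl⟩; positivity⟩

lemma sv_bdd' (T : H →L[ℂ] H) (n : ℕ) :
    BddBelow (Set.range fun u : Fin n → H => ⨅ v : Fin n → H, ‖T - ∑ i, rankOne (u i) (v i)‖) :=
  ⟨0, by rintro _ ⟨v, rfl⟩; exact Real.iInf_nonneg fun _ => norm_nonneg _⟩

lemma sv_le {n : ℕ} (T : H →L[ℂ] H) {A : H →L[ℂ] H} (hA : FR n A) : sv T n ≤ ‖T - A‖ := by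
  obtain ⟨u, v, rfl⟩ := hA
  exact (ciInf_le (sv_bdd' T n) u).trans (ciInf_le (sv_bdd T n u) v)

lemma sv_nonneg (T : H →L[ℂ] H) (n : ℕ) : 0 ≤ sv T n :=
  Real.iInf_nonneg fun _ => Real.iInf_nonneg fun _ => norm_nonneg _

lemma exists_of_sv_lt {n : ℕ} (T : H →L[ℂ] H) {c : ℝ} (h : sv T n < c) :
    ∃ A, FR n A ∧ ‖T - A‖ < c := by
  obtain ⟨u, hu⟩ := exists_lt_of_ciInf_lt h
  obtain ⟨v, hv⟩ := exists_lt_of_ciInf_lt hu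
  exact ⟨_, ⟨u, v, rfl⟩, hv⟩

lemma sv_antitone (T : H →L[ℂ] H) : Antitone (sv T) := by
  intro m n h
  refine le_of_forall_gt fun c hc => ?_
  obtain ⟨A, hA, h1⟩ := exists_of_sv_lt T hc
  exact (sv_le T (hA.mono h)).trans_lt h1

variable [CompleteSpace H]

lemma FR.mul_right {n : ℕ} {A : H →L[ℂ] H} (hA : FR n A) (X : H →L[ℂ] H) : FR n (A * X) := by
  obtain ⟨u, v, rfl⟩ := hA
  refine ⟨fun i => ContinuousLinearMap.adjoint X (u i), v, ?_⟩
  ext x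
  simp [rankOne_apply', ContinuousLinearMap.adjoint_inner_left]

/-- absolute trace bound for finite rank operators -/
lemma FR.trace_bound {n : ℕ} {A : H →L[ℂ] H} (hA : FR n A) (e : HilbertBasis ℕ ℂ H)
    (F : Finset ℕ) : ∑ i ∈ F, ‖⟪e i, A (e i)⟫_ℂ‖ ≤ n * ‖A‖ := by
  obtain ⟨u, v, hA⟩ := hA
  let S : Submodule ℂ H := Submodule.span ℂ (Set.range v)
  have : FiniteDimensional ℂ S := FiniteDimensional.span_of_finite ℂ (Set.finite_range v)
  have hmem : ∀ x, A x ∈ S := by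
    intro x
    rw [hA, sum_apply]
    refine Submodule.sum_mem _ fun i _ => ?_
    rw [rankOne_apply']
    exact S.smul_mem _ (Submodule.subset_span ⟨i, rfl⟩)
  have hr : Module.finrank ℂ S ≤ n := by
    have h := finrank_range_le_card (R := ℂ) v
    rw [Fintype.card_fin] at h
    exact h
  let b := stdOrthonormalBasis ℂ S
  have key : ∀ i, ⟪e i, A (e i)⟫_ℂ
      = ∑ j, ⟪e i, (b j : H)⟫_ℂ * ⟪ContinuousLinearMap.adjoint A (b j : H), e i⟫_ℂ := by
    intro i
    have h1 : A (e i) = ∑ j, ⟪(b j : H), A (e i)⟫_ℂ • (b j : H) := by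
      have := congrArg (Subtype.val) (b.sum_repr' ⟨A (e i), hmem _⟩)
      simpa using this.symm
    conv_lhs => rw [h1]
    rw [inner_sum]
    refine Finset.sum_congr rfl fun j _ => ?_
    rw [inner_smul_right, ContinuousLinearMap.adjoint_inner_left, mul_comm]
  calc ∑ i ∈ F, ‖⟪e i, A (e i)⟫_ℂ‖
      ≤ ∑ i ∈ F, ∑ j, ‖⟪e i, (b j : H)⟫_ℂ‖ * ‖⟪e i, ContinuousLinearMap.adjoint A (b j : H)⟫_ℂ‖ := by
        refine Finset.sum_le_sum fun i _ => ?_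
        rw [key]
        refine (norm_sum_le _ _).trans (Finset.sum_le_sum fun j _ => ?_)
        rw [norm_mul, norm_inner_symm (ContinuousLinearMap.adjoint A (b j : H))]
    _ = ∑ j, ∑ i ∈ F, ‖⟪e i, (b j : H)⟫_ℂ‖ * ‖⟪e i, ContinuousLinearMap.adjoint A (b j : H)⟫_ℂ‖ :=
        Finset.sum_comm
    _ ≤ ∑ j : Fin (Module.finrank ℂ S), ‖A‖ := by
        refine Finset.sum_le_sum fun j _ => ?_
        have hb : ‖(b j : H)‖ = 1 := b.orthonormal.1 j
        have h1 := e.orthonormal.sum_inner_products_le (b j : H) (s := F)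
        have h2 := e.orthonormal.sum_inner_products_le
          (ContinuousLinearMap.adjoint A (b j : H)) (s := F)
        have h3 : ‖ContinuousLinearMap.adjoint A (b j : H)‖ ≤ ‖A‖ := by
          have := (ContinuousLinearMap.adjoint A).le_opNorm (b j : H)
          rwa [hb, mul_one, LinearIsometryEquiv.norm_map] at this
        have h4 := Finset.sum_mul_sq_le_sq_mul_sq F (fun i => ‖⟪e i, (b j : H)⟫_ℂ‖)
          (fun i => ‖⟪e i, ContinuousLinearMap.adjoint A (b j : H)⟫_ℂ‖)
        refine abs_le_of_sq_le_sq' ?_ (norm_nonneg _) |>.2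
        refine h4.trans ?_
        rw [hb] at h1
        calc _ ≤ 1 ^ 2 * ‖ContinuousLinearMap.adjoint A (b j : H)‖ ^ 2 := by gcongr
          _ ≤ 1 ^ 2 * ‖A‖ ^ 2 := by gcongr
          _ = _ := by ring
    _ ≤ n * ‖A‖ := by
        simp only [Finset.sum_const, Finset.card_univ, Fintype.card_fin, nsmul_eq_mul]
        gcongr

lemma trace_class_bound (e : HilbertBasis ℕ ℂ H) (D : H →L[ℂ] H) (A : ℕ → H →L[ℂ] H) (s : ℕ → ℝ)
    (hA : ∀ n, FR (3 * n) (A n)) (hs0 : ∀ n, 0 ≤ s n) (hs : Antitone s) (hsum : Summable s)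
    (hD : ∀ n, ‖D - A n‖ ≤ s n) (F : Finset ℕ) :
    ∑ i ∈ F, ‖⟪e i, D (e i)⟫_ℂ‖ ≤ 100 * ∑' n, s n := by
  have hA0 : A 0 = 0 := by
    obtain ⟨u, v, h⟩ := hA 0
    rw [h]; simp
  have hS : ∀ t : Finset ℕ, ∑ n ∈ t, s n ≤ ∑' n, s n := fun t =>
    hsum.sum_le_tsum t fun i _ => hs0 i
  have h0 : s 0 ≤ ∑' n, s n := by simpa using hS {0}
  have h1 : s 1 ≤ ∑' n, s n := by simpa using hS {1}
  have tri : ∀ a b : ℕ, ‖A a - A b‖ ≤ s a + s b := by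
    intro a b
    have : A a - A b = (D - A b) - (D - A a) := by abel
    rw [this]
    refine (norm_sub_le _ _).trans ?_
    linarith [hD a, hD b]
  have hstep : ∀ k : ℕ, ∑ i ∈ F, ‖⟪e i, A (2 ^ k) (e i)⟫_ℂ‖
      ≤ 3 * (s 0 + s 1) + ∑ j ∈ Finset.range k, 18 * (2 ^ j * s (2 ^ j)) := by
    intro k
    induction k with
    | zero =>
      have h2 := (hA 1).trace_bound e F
      have h3 := tri 1 0
      rw [hA0, sub_zero] at h3
      simp only [pow_zero, Finset.range_zero, Finset.sum_empty, add_zero]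
      refine h2.trans ?_
      push_cast
      linarith
    | succ k ih =>
      rw [Finset.sum_range_succ, ← add_assoc]
      have h2 := ((hA (2 ^ (k + 1))).sub (hA (2 ^ k))).trace_bound e F
      have h3 := tri (2 ^ (k + 1)) (2 ^ k)
      have h4 : s (2 ^ (k + 1)) ≤ s (2 ^ k) :=
        hs (Nat.pow_le_pow_right (by norm_num) (Nat.le_succ k))
      have h5 : ∑ i ∈ F, ‖⟪e i, A (2 ^ (k + 1)) (e i)⟫_ℂ‖ ≤ ∑ i ∈ F, ‖⟪e i, A (2 ^ k) (e i)⟫_ℂ‖ +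
          ∑ i ∈ F, ‖⟪e i, (A (2 ^ (k + 1)) - A (2 ^ k)) (e i)⟫_ℂ‖ := by
        rw [← Finset.sum_add_distrib]
        refine Finset.sum_le_sum fun i _ => ?_
        refine le_trans (le_of_eq ?_) (norm_add_le _ _)
        rw [← inner_add_right]
        simp
      have h6 : ((3 * 2 ^ (k + 1) + 3 * 2 ^ k : ℕ) : ℝ) * ‖A (2 ^ (k + 1)) - A (2 ^ k)‖
          ≤ 18 * (2 ^ k * s (2 ^ k)) := by
        calc _ ≤ ((3 * 2 ^ (k + 1) + 3 * 2 ^ k : ℕ) : ℝ) * (2 * s (2 ^ k)) := by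
              gcongr; linarith
          _ = _ := by push_cast; ring
      linarith
  have hcond : ∀ k : ℕ, ∑ j ∈ Finset.range k, 2 ^ j * s (2 ^ j) ≤ 3 * ∑' n, s n := by
    intro k
    have h2 := Finset.sum_condensed_le (f := s) (fun m n _ h => hs h) k
    simp only [nsmul_eq_mul] at h2
    push_cast at h2
    have h3 := hS (Finset.Ico 2 (2 ^ k + 1))
    rw [Finset.sum_range_succ] at h2
    have h4 : 0 ≤ (2 : ℝ) ^ k * s (2 ^ k) := mul_nonneg (by positivity) (hs0 _)
    linarith
  have hbound : ∀ k : ℕ, ∑ i ∈ F, ‖⟪e i, D (e i)⟫_ℂ‖ ≤ 60 * ∑' n, s n + F.card * s (2 ^ k) := by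
    intro k
    have h2 := hstep k
    rw [← Finset.mul_sum] at h2
    have h3 := hcond k
    have h5 : ∑ i ∈ F, ‖⟪e i, D (e i)⟫_ℂ‖ ≤ ∑ i ∈ F, ‖⟪e i, A (2 ^ k) (e i)⟫_ℂ‖ +
          ∑ i ∈ F, s (2 ^ k) := by
      rw [← Finset.sum_add_distrib]
      refine Finset.sum_le_sum fun i _ => ?_
      have h6 : ‖⟪e i, (D - A (2 ^ k)) (e i)⟫_ℂ‖ ≤ s (2 ^ k) := by
        refine (norm_inner_le_norm _ _).trans ?_
        have := (D - A (2 ^ k)).le_opNorm (e i)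
        rw [e.orthonormal.1 i] at *
        linarith [hD (2 ^ k)]
      have h7 : ⟪e i, D (e i)⟫_ℂ = ⟪e i, A (2 ^ k) (e i)⟫_ℂ + ⟪e i, (D - A (2 ^ k)) (e i)⟫_ℂ := by
        rw [← inner_add_right]; simp
      rw [h7]
      exact (norm_add_le _ _).trans (by linarith)
    rw [Finset.sum_const, nsmul_eq_mul] at h5
    linarith
  have hlim : Tendsto (fun k : ℕ => 60 * ∑' n, s n + F.card * s (2 ^ k)) atTop
      (nhds (60 * ∑' n, s n + F.card * 0)) := by
    refine tendsto_const_nhds.add (tendsto_const_nhds.mul ?_)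
    exact hsum.tendsto_atTop_zero.comp (tendsto_pow_atTop_atTop_of_one_lt (by norm_num))
  have := ge_of_tendsto' hlim hbound
  have h9 : 0 ≤ ∑' n, s n := tsum_nonneg hs0
  linarith

lemma trace_bound_of_approx (e : HilbertBasis ℕ ℂ H) (D : H →L[ℂ] H) (s : ℕ → ℝ)
    (hA : ∀ n, ∃ A, FR (3 * n) A ∧ ‖D - A‖ ≤ s n) (hs : Antitone s) (hsum : Summable s) :
    (Summable fun i => ⟪e i, D (e i)⟫_ℂ) ∧ ‖traceAlong e D‖ ≤ 100 * ∑' n, s n := by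
  choose A hA1 hA2 using hA
  have hs0 : ∀ n, 0 ≤ s n := fun n => (norm_nonneg _).trans (hA2 n)
  have h := trace_class_bound e D A s hA1 hs0 hs hsum hA2
  have h1 : Summable fun i => ‖⟪e i, D (e i)⟫_ℂ‖ :=
    summable_of_sum_le (fun _ => norm_nonneg _) h
  refine ⟨h1.of_norm, ?_⟩
  exact (norm_tsum_le_tsum_norm h1).trans (h1.tsum_le_of_sum_le h)

lemma FR.summable {n : ℕ} {A : H →L[ℂ] H} (hA : FR n A) (e : HilbertBasis ℕ ℂ H) :
    Summable fun i => ⟪e i, A (e i)⟫_ℂ := by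
  have h1 : Summable fun i => ‖⟪e i, A (e i)⟫_ℂ‖ :=
    summable_of_sum_le (fun _ => norm_nonneg _) (hA.trace_bound e)
  exact h1.of_norm

lemma norm_mul3_le {α : ℝ} {A X : H →L[ℂ] H} (hX : ‖X‖ ≤ 1) (hA : ‖A‖ ≤ α) : ‖A * X‖ ≤ α := by
  refine (norm_mul_le _ _).trans ?_
  nlinarith [norm_nonneg A, norm_nonneg X]

lemma prod_approx {a b : ℕ} {α β : ℝ} {A B A' B' X Y : H →L[ℂ] H} (hA : FR a A') (hB : FR b B')
    (hα : ‖A - A'‖ ≤ α) (hβ : ‖B - B'‖ ≤ β) (hX : ‖X‖ ≤ 1) (hY : ‖Y‖ ≤ 1) :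
    ∃ D', FR (a + b) D' ∧ ‖A * X * B * Y - D'‖ ≤ α * β := by
  refine ⟨A' * X * B * Y + (A - A') * X * B' * Y, ?_, ?_⟩
  · exact (((hA.mul_right _).mul_right _).mul_right _).add ((hB.mul_left _).mul_right _)
  · have : A * X * B * Y - (A' * X * B * Y + (A - A') * X * B' * Y)
      = (A - A') * X * (B - B') * Y := by noncomm_ring
    rw [this]
    refine norm_mul3_le hY ((norm_mul_le _ _).trans ?_)
    have := norm_mul3_le hX hα
    exact mul_le_mul this hβ (norm_nonneg _) ((norm_nonneg _).trans this)

lemma cut_approx {n : ℕ} {c : ℝ} {C C' P : H →L[ℂ] H} (hP : ‖P‖ ≤ 1) (hC : FR n C')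
    (hc : ‖C - C'‖ ≤ c) :
    ∃ A', FR (2 * n) A' ∧ ‖(C - P * C * P) - A'‖ ≤ min (2 * c) ‖C - P * C * P‖ := by
  rcases le_total (2 * c) ‖C - P * C * P‖ with h | h
  · rw [min_eq_left h]
    refine ⟨C' - P * C' * P, ?_, ?_⟩
    · rw [two_mul]
      exact hC.sub ((hC.mul_left _).mul_right _)
    · have : C - P * C * P - (C' - P * C' * P) = (C - C') - P * (C - C') * P := by noncomm_ring
      rw [this]
      refine (norm_sub_le _ _).trans ?_
      have : ‖P * (C - C') * P‖ ≤ c := by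
        refine norm_mul3_le hP ((norm_mul_le _ _).trans ?_)
        nlinarith [norm_nonneg P, norm_nonneg (C - C')]
      linarith
  · rw [min_eq_right h]
    exact ⟨0, FR.zero _, by simp⟩

noncomputable def iota (e : HilbertBasis ℕ ℂ H) (m : ℕ) : EuclideanSpace ℂ (Fin m) →L[ℂ] H :=
  ∑ i : Fin m, (EuclideanSpace.proj i : EuclideanSpace ℂ (Fin m) →L[ℂ] ℂ).smulRight (e i)

lemma iota_apply (e : HilbertBasis ℕ ℂ H) (m : ℕ) (x : EuclideanSpace ℂ (Fin m)) :
    iota e m x = ∑ i, x i • e (i : ℕ) := by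
  simp [iota, sum_apply]

lemma iota_single (e : HilbertBasis ℕ ℂ H) (m : ℕ) (j : Fin m) :
    iota e m (EuclideanSpace.single j 1) = e j := by
  simp [iota_apply, Pi.single_apply]

lemma iota_adj (e : HilbertBasis ℕ ℂ H) (m : ℕ) (x : H) (i : Fin m) :
    (ContinuousLinearMap.adjoint (iota e m) x) i = ⟪e i, x⟫_ℂ := by
  have := ContinuousLinearMap.adjoint_inner_right (iota e m) (EuclideanSpace.single i 1) x
  rw [iota_single, EuclideanSpace.inner_single_left] at this
  simpa using this

lemma iota_adj_comp (e : HilbertBasis ℕ ℂ H) (m : ℕ) :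
    (ContinuousLinearMap.adjoint (iota e m)) ∘L (iota e m) = 1 := by
  ext x i
  have h := orthonormal_iff_ite.1 e.orthonormal
  simp [iota_adj, iota_apply, inner_sum, inner_smul_right, h, Fin.val_inj]

lemma iota_norm (e : HilbertBasis ℕ ℂ H) (m : ℕ) : ‖iota e m‖ ≤ 1 := by
  refine ContinuousLinearMap.opNorm_le_bound _ zero_le_one fun x => ?_
  have h : ⟪x, ((ContinuousLinearMap.adjoint (iota e m)) ∘L (iota e m)) x⟫_ℂ = ⟪x, x⟫_ℂ := by
    rw [iota_adj_comp]; rfl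
  rw [ContinuousLinearMap.comp_apply, ContinuousLinearMap.adjoint_inner_right,
    inner_self_eq_norm_sq_to_K, inner_self_eq_norm_sq_to_K] at h
  have h2 : ‖iota e m x‖ ^ 2 = ‖x‖ ^ 2 := by exact_mod_cast h
  have h3 := (sq_eq_sq₀ (norm_nonneg _) (norm_nonneg _)).1 h2
  linarith

noncomputable def PP (e : HilbertBasis ℕ ℂ H) (m : ℕ) : H →L[ℂ] H :=
  iota e m ∘L ContinuousLinearMap.adjoint (iota e m)

lemma PP_norm (e : HilbertBasis ℕ ℂ H) (m : ℕ) : ‖PP e m‖ ≤ 1 := by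
  refine (ContinuousLinearMap.opNorm_comp_le _ _).trans ?_
  rw [LinearIsometryEquiv.norm_map]
  nlinarith [iota_norm e m, norm_nonneg (iota e m)]

lemma PP_apply (e : HilbertBasis ℕ ℂ H) (m : ℕ) (x : H) :
    PP e m x = ∑ i ∈ Finset.range m, ⟪e i, x⟫_ℂ • e i := by
  rw [PP, ContinuousLinearMap.comp_apply, iota_apply, Finset.sum_range]
  simp [iota_adj]

lemma PP_star (e : HilbertBasis ℕ ℂ H) (m : ℕ) : ContinuousLinearMap.adjoint (PP e m) = PP e m := by
  rw [PP, ContinuousLinearMap.adjoint_comp, ContinuousLinearMap.adjoint_adjoint]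

lemma PP_FR (e : HilbertBasis ℕ ℂ H) (m : ℕ) : FR m (PP e m) := by
  refine ⟨fun i => e i, fun i => e i, ?_⟩
  ext x
  rw [PP_apply, Finset.sum_range]
  simp [sum_apply, rankOne_apply']

lemma PP_tendsto (e : HilbertBasis ℕ ℂ H) (x : H) :
    Tendsto (fun m => PP e m x) atTop (nhds x) := by
  have := (e.hasSum_repr x).tendsto_sum_nat
  simpa [PP_apply, HilbertBasis.repr_apply_apply] using this

lemma compact_step (e : HilbertBasis ℕ ℂ H) {C : H →L[ℂ] H} (hC : IsCompactOperator C) {ε : ℝ}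
    (hε : 0 < ε) : ∃ m, ‖C - PP e m * C‖ ≤ ε := by
  obtain ⟨K, hK, hKs⟩ := IsCompactOperator.image_closedBall_subset_compact
    (f := (C : H →ₗ[ℂ] H)) hC 1
  obtain ⟨t, -, htf, ht⟩ := hK.finite_cover_balls (e := ε / 4) (by positivity)
  have h1 : ∀ᶠ m in atTop, ∀ y ∈ t, dist (PP e m y) y < ε / 4 := by
    rw [Filter.eventually_all_finite htf]
    intro y _
    exact (Metric.tendsto_nhds.1 (PP_tendsto e y)) _ (by positivity)
  obtain ⟨m, hm⟩ := h1.exists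
  refine ⟨m, ?_⟩
  refine ContinuousLinearMap.opNorm_le_of_unit_norm hε.le fun x hx => ?_
  have hx' : C x ∈ K := hKs ⟨x, by simp [hx], rfl⟩
  obtain ⟨y, hy, hxy⟩ := Set.mem_iUnion₂.1 (ht hx')
  have hxy' : ‖C x - y‖ < ε / 4 := by simpa [dist_eq_norm] using hxy
  have h2 := hm y hy
  rw [dist_eq_norm, norm_sub_rev] at h2
  have h3 : (C - PP e m * C) x = (C x - y) + (y - PP e m y) - PP e m (C x - y) := by
    simp
  rw [h3]
  have h4 := (PP e m).le_opNorm (C x - y)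
  have h5 := PP_norm e m
  have h6 := norm_sub_le ((C x - y) + (y - PP e m y)) (PP e m (C x - y))
  have h7 := norm_add_le (C x - y) (y - PP e m y)
  nlinarith [norm_nonneg (C x - y)]

lemma rankOne_cont : Continuous fun p : H × H => rankOne p.1 p.2 := by
  have h := (ContinuousLinearMap.smulRightL ℂ H H).continuous₂
  exact h.comp (((innerSL ℂ).continuous.comp continuous_fst).prodMk continuous_snd)

lemma rankOne_cut (e : HilbertBasis ℕ ℂ H) (m : ℕ) (u v : H) :
    PP e m * rankOne u v * PP e m = rankOne (PP e m u) (PP e m v) := by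
  ext x
  have h1 : (PP e m * rankOne u v * PP e m) x = PP e m (rankOne u v (PP e m x)) := rfl
  have h2 : ⟪PP e m u, x⟫_ℂ = ⟪u, PP e m x⟫_ℂ := by
    conv_lhs => rw [← PP_star, ContinuousLinearMap.adjoint_inner_left]
  rw [h1, rankOne_apply', rankOne_apply', map_smul, h2]

lemma rankOne_cut_tendsto (e : HilbertBasis ℕ ℂ H) (u v : H) :
    Tendsto (fun m => PP e m * rankOne u v * PP e m) atTop (nhds (rankOne u v)) := by
  have h1 := rankOne_cont.tendsto (u, v)
  have h2 := (PP_tendsto e u).prodMk_nhds (PP_tendsto e v)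
  have h3 := Tendsto.comp h1 h2
  refine h3.congr fun m => ?_
  exact (rankOne_cut e m u v).symm

lemma FR_cut (e : HilbertBasis ℕ ℂ H) {n : ℕ} {A : H →L[ℂ] H} (hA : FR n A) :
    Tendsto (fun m => PP e m * A * PP e m) atTop (nhds A) := by
  obtain ⟨u, v, hA⟩ := hA
  have h : ∀ m, ∑ i, PP e m * rankOne (u i) (v i) * PP e m = PP e m * A * PP e m := by
    intro m
    rw [hA, Finset.mul_sum, Finset.sum_mul]
  have h4 := tendsto_finsetSum Finset.univ
    (fun (i : Fin n) _ => rankOne_cut_tendsto e (u i) (v i))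
  rw [← hA] at h4
  exact h4.congr h

lemma compact_cut (e : HilbertBasis ℕ ℂ H) {C : H →L[ℂ] H} (hC : IsCompactOperator C) :
    Tendsto (fun m => ‖C - PP e m * C * PP e m‖) atTop (nhds 0) := by
  rw [Metric.tendsto_nhds]
  intro ε hε
  obtain ⟨k, hk⟩ := compact_step e hC (ε := ε / 4) (by positivity)
  set A := PP e k * C with hA
  have hFR : FR k A := (PP_FR e k).mul_right C
  filter_upwards [(Metric.tendsto_nhds.1 (FR_cut e hFR)) (ε / 4) (by positivity)] with m hm
  rw [dist_eq_norm, norm_sub_rev] at hm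
  rw [dist_zero_right, norm_norm]
  have h1 : C - PP e m * C * PP e m = (A - PP e m * A * PP e m) + (C - A)
      - PP e m * (C - A) * PP e m := by noncomm_ring
  rw [h1]
  have h2 : ‖PP e m * (C - A) * PP e m‖ ≤ ε / 4 := by
    refine norm_mul3_le (PP_norm e m) ((norm_mul_le _ _).trans ?_)
    nlinarith [norm_nonneg (PP e m), norm_nonneg (C - A), PP_norm e m]
  have h6 := norm_sub_le ((A - PP e m * A * PP e m) + (C - A)) (PP e m * (C - A) * PP e m)
  have h7 := norm_add_le (A - PP e m * A * PP e m) (C - A)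
  linarith

lemma tsum_min_tendsto {c b : ℕ → ℝ} (hc : ∀ n, 0 ≤ c n) (hb : ∀ n, 0 ≤ b n)
    (hsum : Summable fun n => c n * b n) {δ : ℕ → ℝ} (hδ0 : ∀ m, 0 ≤ δ m)
    (hδ : Tendsto δ atTop (nhds 0)) :
    Tendsto (fun m => ∑' n, min (2 * c n) (δ m) * b n) atTop (nhds 0) := by
  have h := tendsto_tsum_of_dominated_convergence (𝓕 := atTop)
    (f := fun m n => min (2 * c n) (δ m) * b n) (g := fun _ => (0 : ℝ))
    (bound := fun n => 2 * (c n * b n)) (hsum.mul_left 2) ?_ ?_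
  · simpa using h
  · intro n
    have h1 : Tendsto (fun m => δ m * b n) atTop (nhds 0) := by
      simpa using hδ.mul_const (b n)
    refine squeeze_zero (fun m => ?_) (fun m => ?_) h1
    · exact mul_nonneg (le_min (by linarith [hc n]) (hδ0 m)) (hb n)
    · exact mul_le_mul_of_nonneg_right (min_le_right _ _) (hb n)
  · refine Eventually.of_forall fun m n => ?_
    rw [Real.norm_of_nonneg (mul_nonneg (le_min (by linarith [hc n]) (hδ0 m)) (hb n))]
    rw [← mul_assoc]
    exact mul_le_mul_of_nonneg_right (min_le_left _ _) (hb n)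

lemma min_props {c b : ℕ → ℝ} (hc0 : ∀ n, 0 ≤ c n) (hb0 : ∀ n, 0 ≤ b n)
    (hc : Antitone c) (hb : Antitone b)
    (hsum : Summable fun n => c n * b n) {δ : ℝ} (hδ0 : 0 ≤ δ) :
    (Antitone fun n => min (2 * c n) δ * b n) ∧ Summable fun n => min (2 * c n) δ * b n := by
  have hn : ∀ n, 0 ≤ min (2 * c n) δ := fun n => le_min (by linarith [hc0 n]) hδ0
  constructor
  · intro m n h
    refine mul_le_mul ?_ (hb h) (hb0 n) (hn m)
    exact min_le_min_right _ (by linarith [hc h])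
  · refine Summable.of_nonneg_of_le (fun n => mul_nonneg (hn n) (hb0 n)) (fun n => ?_)
      (hsum.mul_left 2)
    rw [← mul_assoc]
    exact mul_le_mul_of_nonneg_right (min_le_left _ _) (hb0 n)

lemma claim (e g : HilbertBasis ℕ ℂ H) (C T : H →L[ℂ] H) (hC : IsCompactOperator C)
    (hT : IsCompactOperator T) (c b : ℕ → ℝ) (hca : Antitone c) (hba : Antitone b)
    (hsum : Summable fun n => c n * b n)
    (hc : ∀ n, ∃ A, FR n A ∧ ‖C - A‖ ≤ c n) (hb : ∀ n, ∃ A, FR n A ∧ ‖T - A‖ ≤ b n)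
    {ε : ℝ} (hε : 0 < ε) :
    ∃ N, ∀ m ≥ N, ∀ X Y : H →L[ℂ] H, ‖X‖ ≤ 1 → ‖Y‖ ≤ 1 →
      ‖traceAlong e (C * X * T * Y) - traceAlong e
        ((PP e m * C * PP e m) * X * (PP g m * T * PP g m) * Y)‖ ≤ ε := by
  have hc0 : ∀ n, 0 ≤ c n := fun n => by
    obtain ⟨A, -, h⟩ := hc n; exact (norm_nonneg _).trans h
  have hb0 : ∀ n, 0 ≤ b n := fun n => by
    obtain ⟨A, -, h⟩ := hb n; exact (norm_nonneg _).trans h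
  have hsum' : Summable fun n => b n * c n := by simpa only [mul_comm] using hsum
  have l1 := (tsum_min_tendsto hc0 hb0 hsum (fun m => norm_nonneg _) (compact_cut e hC))
  have l2 := (tsum_min_tendsto hb0 hc0 hsum' (fun m => norm_nonneg _) (compact_cut g hT))
  have l := (l1.add l2).const_mul 100
  simp only [add_zero, mul_zero] at l
  obtain ⟨N, hN⟩ := eventually_atTop.1 (l.eventually_lt_const hε)
  refine ⟨N, fun m hm X Y hX hY => ?_⟩
  have hNm := hN m hm
  clear hN l l1 l2
  set P := PP e m with hP
  set Q := PP g m with hQ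
  have hP1 : ‖P‖ ≤ 1 := PP_norm e m
  have hQ1 : ‖Q‖ ≤ 1 := PP_norm g m
  obtain ⟨a1, s1⟩ := min_props hc0 hb0 hca hba hsum (norm_nonneg (C - P * C * P))
  obtain ⟨a2, s2⟩ := min_props hb0 hc0 hba hca hsum' (norm_nonneg (T - Q * T * Q))
  obtain ⟨t1, n1⟩ := trace_bound_of_approx e ((C - P * C * P) * X * T * Y) _ (fun n => by
    obtain ⟨A, hA, hA'⟩ := hc n
    obtain ⟨B, hB, hB'⟩ := hb n
    obtain ⟨A2, h1, h2⟩ := cut_approx hP1 hA hA'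
    obtain ⟨D, hD, hD'⟩ := prod_approx h1 hB h2 hB' hX hY
    exact ⟨D, hD.mono (by omega), hD'⟩) a1 s1
  obtain ⟨t2, n2⟩ := trace_bound_of_approx e ((P * C * P) * X * (T - Q * T * Q) * Y) _ (fun n => by
    obtain ⟨A, hA, hA'⟩ := hc n
    obtain ⟨B, hB, hB'⟩ := hb n
    obtain ⟨B2, h1, h2⟩ := cut_approx hQ1 hB hB'
    have h3 : ‖P * C * P - P * A * P‖ ≤ c n := by
      have : P * C * P - P * A * P = P * (C - A) * P := by noncomm_ring
      rw [this]
      refine norm_mul3_le hP1 ((norm_mul_le _ _).trans ?_)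
      nlinarith [norm_nonneg P, norm_nonneg (C - A)]
    obtain ⟨D, hD, hD'⟩ := prod_approx ((hA.mul_left P).mul_right P) h1 h3 h2 hX hY
    exact ⟨D, hD.mono (by omega), by rw [mul_comm]; exact hD'⟩) a2 s2
  have t3 : Summable fun i => ⟪e i, ((P * C * P) * X * (Q * T * Q) * Y) (e i)⟫_ℂ := by
    have : FR m ((P * C * P) * X * (Q * T * Q) * Y) :=
      ((((PP_FR e m).mul_right _).mul_right _).mul_right _).mul_right _ |>.mul_right _
    exact this.summable e
  have hdec : C * X * T * Y = (C - P * C * P) * X * T * Y + (P * C * P) * X * (T - Q * T * Q) * Y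
      + (P * C * P) * X * (Q * T * Q) * Y := by noncomm_ring
  have htr : traceAlong e (C * X * T * Y) = traceAlong e ((C - P * C * P) * X * T * Y)
      + traceAlong e ((P * C * P) * X * (T - Q * T * Q) * Y)
      + traceAlong e ((P * C * P) * X * (Q * T * Q) * Y) := by
    rw [hdec]
    unfold traceAlong
    rw [← t1.tsum_add t2, ← (t1.add t2).tsum_add t3]
    refine tsum_congr fun i => ?_
    rw [add_apply, add_apply, inner_add_right,
      inner_add_right]
  rw [htr, add_sub_cancel_right]
  refine (norm_add_le _ _).trans ?_
  linarith

lemma schatten_seq {p : ℝ≥0∞} (hp : p ≠ 0) {C : H →L[ℂ] H} (hC : MemSchatten p C) :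
    ∃ c : ℕ → ℝ, Antitone c ∧ (∀ n, 0 ≤ c n) ∧ (∀ n, ∃ A, FR n A ∧ ‖C - A‖ ≤ c n) ∧
      (p ≠ ∞ → Summable fun n => c n ^ p.toReal) := by
  refine ⟨fun n => max (2 * sv C n) ((1 / 2 : ℝ) ^ n), ?_, ?_, ?_, ?_⟩
  · intro m n h
    refine max_le_max ?_ ?_
    · linarith [sv_antitone C h]
    · exact pow_le_pow_of_le_one (by norm_num) (by norm_num) h
  · intro n
    exact le_max_of_le_right (by positivity)
  · intro n
    have : sv C n < max (2 * sv C n) ((1 / 2 : ℝ) ^ n) := by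
      rcases (sv_nonneg C n).eq_or_lt with h | h
      · rw [← h]; exact lt_max_of_lt_right (by positivity)
      · exact lt_max_of_lt_left (by linarith)
    obtain ⟨A, hA, h⟩ := exists_of_sv_lt C this
    exact ⟨A, hA, h.le⟩
  · intro hp'
    have hpos : 0 < p.toReal := ENNReal.toReal_pos hp hp'
    have h1 : Summable fun n => 2 ^ p.toReal * sv C n ^ p.toReal + ((1 / 2 : ℝ) ^ p.toReal) ^ n := by
      refine ((hC.2 hp').mul_left _).add (summable_geometric_of_lt_one (by positivity) ?_)
      exact Real.rpow_lt_one (by norm_num) (by norm_num) hpos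
    refine Summable.of_nonneg_of_le (fun n => by positivity) (fun n => ?_) h1
    have h2 : (2 * sv C n) ^ p.toReal = 2 ^ p.toReal * sv C n ^ p.toReal :=
      Real.mul_rpow (by norm_num) (sv_nonneg C n)
    have h3 : ((1 / 2 : ℝ) ^ n) ^ p.toReal = ((1 / 2 : ℝ) ^ p.toReal) ^ n := by
      rw [← Real.rpow_natCast, ← Real.rpow_mul (by norm_num), mul_comm, Real.rpow_mul (by norm_num),
        Real.rpow_natCast]
    have h4 : 0 ≤ 2 ^ p.toReal * sv C n ^ p.toReal := by
      have := sv_nonneg C n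
      positivity
    have h5 : 0 ≤ ((1 / 2 : ℝ) ^ p.toReal) ^ n := by positivity
    beta_reduce
    rcases max_choice (2 * sv C n) ((1 / 2 : ℝ) ^ n) with h | h <;> rw [h]
    · rw [h2]; linarith
    · rw [h3]; linarith

lemma summable_endpoint {p : ℝ≥0∞} (hp : p = 1) {c b : ℕ → ℝ} (hb : Antitone b)
    (hc0 : ∀ n, 0 ≤ c n) (hb0 : ∀ n, 0 ≤ b n)
    (h : p ≠ ∞ → Summable fun n => c n ^ p.toReal) : Summable fun n => c n * b n := by
  subst hp
  have h1 := h (by simp)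
  simp only [ENNReal.toReal_one, Real.rpow_one] at h1
  refine Summable.of_nonneg_of_le (fun n => mul_nonneg (hc0 n) (hb0 n)) (fun n => ?_)
    (h1.mul_right (b 0))
  exact mul_le_mul_of_nonneg_left (hb (Nat.zero_le n)) (hc0 n)

lemma summable_prod {p q : ℝ≥0∞} (hpq : 1 / p + 1 / q = 1) {c b : ℕ → ℝ}
    (hc : Antitone c) (hb : Antitone b) (hc0 : ∀ n, 0 ≤ c n) (hb0 : ∀ n, 0 ≤ b n)
    (h1 : p ≠ ∞ → Summable fun n => c n ^ p.toReal)
    (h2 : q ≠ ∞ → Summable fun n => b n ^ q.toReal) : Summable fun n => c n * b n := by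
  by_cases hp : p = ∞
  · have hq : q = 1 := by
      subst hp; simpa using hpq
    have := summable_endpoint hq hc hb0 hc0 h2
    simpa only [mul_comm] using this
  by_cases hq : q = ∞
  · have hp : p = 1 := by
      subst hq; simpa using hpq
    exact summable_endpoint hp hb hc0 hb0 h1
  have hp0 : p ≠ 0 := by rintro rfl; simp at hpq
  have hq0 : q ≠ 0 := by rintro rfl; simp at hpq
  have hpp := ENNReal.toReal_pos hp0 hp
  have hqp := ENNReal.toReal_pos hq0 hq
  have hr : p.toReal⁻¹ + q.toReal⁻¹ = 1 := by
    have := congrArg ENNReal.toReal hpq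
    rw [ENNReal.toReal_add (by simp [hp0]) (by simp [hq0])] at this
    simpa using this
  have hconj : p.toReal.HolderConjugate q.toReal := by
    rw [Real.holderConjugate_iff]
    refine ⟨?_, hr⟩
    have : p.toReal⁻¹ < 1 := by have := inv_pos.2 hqp; linarith
    exact (inv_lt_one₀ hpp).1 this
  refine Summable.of_nonneg_of_le (fun n => mul_nonneg (hc0 n) (hb0 n)) (fun n => ?_)
    (((h1 hp).div_const p.toReal).add ((h2 hq).div_const q.toReal))
  exact Real.young_inequality_of_nonneg (hc0 n) (hb0 n) hconj

noncomputable def corner (e g : HilbertBasis ℕ ℂ H) (m : ℕ) (U : H →L[ℂ] H) :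
    Matrix (Fin m) (Fin m) ℂ := Matrix.of fun i j => ⟪g (i : ℕ), U (e (j : ℕ))⟫_ℂ

lemma inner_PP (e : HilbertBasis ℕ ℂ H) (m : ℕ) (A : H →L[ℂ] H) (x y : H) :
    ⟪x, A (PP e m y)⟫_ℂ = ∑ k : Fin m, ⟪x, A (e k)⟫_ℂ * ⟪e k, y⟫_ℂ := by
  rw [PP_apply, Finset.sum_range, map_sum, inner_sum]
  refine Finset.sum_congr rfl fun k _ => ?_
  rw [map_smul, inner_smul_right, mul_comm]

lemma inner_e_PP (e : HilbertBasis ℕ ℂ H) (m j : ℕ) (y : H) :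
    ⟪e j, PP e m y⟫_ℂ = if j < m then ⟪e j, y⟫_ℂ else 0 := by
  rw [PP_apply, inner_sum]
  have h := orthonormal_iff_ite.1 e.orthonormal
  simp [inner_smul_right, h]

lemma trace_eq (e g : HilbertBasis ℕ ℂ H) (m : ℕ) (C T U : H →L[ℂ] H) :
    traceAlong e ((PP e m * C * PP e m) * star U * (PP g m * T * PP g m) * U)
      = Matrix.trace (cutOut e m C * star (corner e g m U) * cutOut g m T * corner e g m U) := by
  have h1 : ∀ j, ⟪e j, ((PP e m * C * PP e m) * star U * (PP g m * T * PP g m) * U) (e j)⟫_ℂ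
      = if j < m then ⟪e j, C (PP e m (star U (PP g m (T (PP g m (U (e j)))))))⟫_ℂ else 0 := by
    intro j
    rw [← inner_e_PP]
    rfl
  unfold traceAlong
  rw [tsum_eq_sum (s := Finset.range m), Finset.sum_range]
  · rw [Matrix.trace]
    refine Finset.sum_congr rfl fun j _ => ?_
    rw [h1, if_pos j.2, Matrix.diag_apply, mul_assoc, mul_assoc, Matrix.mul_apply, inner_PP]
    refine Finset.sum_congr rfl fun k _ => ?_
    rw [Matrix.mul_apply]
    congr 1
    rw [ContinuousLinearMap.star_eq_adjoint, inner_PP]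
    refine Finset.sum_congr rfl fun l _ => ?_
    rw [Matrix.mul_apply, inner_PP]
    congr 1
    rw [ContinuousLinearMap.adjoint_inner_right, Matrix.star_apply, corner, Matrix.of_apply]
    simp
  · intro j hj
    rw [h1, if_neg (by simpa using hj)]

noncomputable def Phi (g : HilbertBasis ℕ ℂ H) (m : ℕ)
    (v : EuclideanSpace ℂ (Fin m) →L[ℂ] EuclideanSpace ℂ (Fin m)) : H →L[ℂ] H :=
  iota g m ∘L v ∘L ContinuousLinearMap.adjoint (iota g m)

lemma iota_adj_iota (g : HilbertBasis ℕ ℂ H) (m : ℕ) (x : EuclideanSpace ℂ (Fin m)) :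
    ContinuousLinearMap.adjoint (iota g m) (iota g m x) = x := by
  have := congrArg (fun f => f x) (iota_adj_comp g m)
  exact this

lemma Phi_mul (g : HilbertBasis ℕ ℂ H) (m : ℕ)
    (v w : EuclideanSpace ℂ (Fin m) →L[ℂ] EuclideanSpace ℂ (Fin m)) :
    Phi g m v * Phi g m w = Phi g m (v * w) := by
  ext x
  change iota g m (v (ContinuousLinearMap.adjoint (iota g m) (iota g m (w _)))) = _
  rw [iota_adj_iota]
  rfl

lemma Phi_star (g : HilbertBasis ℕ ℂ H) (m : ℕ)
    (v : EuclideanSpace ℂ (Fin m) →L[ℂ] EuclideanSpace ℂ (Fin m)) :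
    star (Phi g m v) = Phi g m (star v) := by
  simp only [ContinuousLinearMap.star_eq_adjoint, Phi, ContinuousLinearMap.adjoint_comp,
    ContinuousLinearMap.adjoint_adjoint, ContinuousLinearMap.comp_assoc]

lemma S_unitary (g : HilbertBasis ℕ ℂ H) (m : ℕ)
    (v : EuclideanSpace ℂ (Fin m) →L[ℂ] EuclideanSpace ℂ (Fin m)) (h1 : star v * v = 1)
    (h2 : v * star v = 1) : Phi g m v + 1 - Phi g m 1 ∈ unitary (H →L[ℂ] H) := by
  rw [Unitary.mem_iff]
  simp only [star_add, star_sub, Phi_star, star_one]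
  constructor <;>
  · simp only [mul_add, add_mul, mul_sub, sub_mul, Phi_mul, h1, h2, mul_one, one_mul]
    abel

lemma exists_extension (e g : HilbertBasis ℕ ℂ H) (m : ℕ) (V : Matrix (Fin m) (Fin m) ℂ)
    (hV : V ∈ Matrix.unitaryGroup (Fin m) ℂ) :
    ∃ U ∈ unitary (H →L[ℂ] H), corner e g m U = V := by
  let v := Matrix.toEuclideanCLM (𝕜 := ℂ) V
  have h1 : star v * v = 1 := by
    rw [← map_star, ← map_mul, (Matrix.mem_unitaryGroup_iff').1 hV, map_one]
  have h2 : v * star v = 1 := by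
    rw [← map_star, ← map_mul, (Matrix.mem_unitaryGroup_iff).1 hV, map_one]
  let W := Unitary.linearIsometryEquiv.symm (e.repr.trans g.repr.symm)
  have hW : ∀ j, (W : H →L[ℂ] H) (e j) = g j := by
    intro j
    change g.repr.symm (e.repr (e j)) = g j
    rw [e.repr_self, ← g.repr_self, LinearIsometryEquiv.symm_apply_apply]
  refine ⟨(Phi g m v + 1 - Phi g m 1) * W, mul_mem (S_unitary g m v h1 h2) W.2, ?_⟩
  ext i j
  have h3 : ((Phi g m v + 1 - Phi g m 1) * (W : H →L[ℂ] H)) (e j)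
      = (Phi g m v + 1 - Phi g m 1) (g j) := by
    rw [← hW]; rfl
  have h4 : ContinuousLinearMap.adjoint (iota g m) (g j) = EuclideanSpace.single j 1 := by
    rw [← iota_single, iota_adj_iota]
  have h5 : (Phi g m v + 1 - Phi g m 1) (g j) = iota g m (v (EuclideanSpace.single j 1)) := by
    have a1 : Phi g m v (g j) = iota g m (v (EuclideanSpace.single j 1)) := by
      rw [← h4]; rfl
    have a2 : Phi g m 1 (g j) = g j := by
      change iota g m (ContinuousLinearMap.adjoint (iota g m) (g j)) = g j
      rw [h4, iota_single]
    rw [sub_apply, add_apply, a1, a2, one_apply_eq_self]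
    simp
  rw [corner, Matrix.of_apply, h3, h5, ← iota_adj, iota_adj_iota]
  simp [v]

open scoped ComplexOrder MatrixOrder Matrix.Norms.L2Operator in
lemma posSemidef_factor {n : ℕ} {G : Matrix (Fin n) (Fin n) ℂ} (hG : G.PosSemidef) :
    ∃ L : Matrix (Fin n) (Fin n) ℂ, G = star L * L :=
  CStarAlgebra.nonneg_iff_eq_star_mul_self.mp hG.nonneg

open scoped ComplexOrder in
lemma exists_dilation (e g : HilbertBasis ℕ ℂ H) (n N : ℕ) (hN : N = n + n) (U : H →L[ℂ] H)
    (hU : U ∈ unitary (H →L[ℂ] H)) :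
    ∃ V ∈ Matrix.unitaryGroup (Fin N) ℂ, ∀ (i j : Fin N), (i : ℕ) < n → (j : ℕ) < n →
      V i j = ⟪g (i : ℕ), U (e (j : ℕ))⟫_ℂ := by
  subst hN
  let w : Fin n → H := fun j => U (e j) - PP g n (U (e j))
  obtain ⟨L, hL⟩ := posSemidef_factor (Matrix.posSemidef_gram (𝕜 := ℂ) w)
  let x : Fin n → EuclideanSpace ℂ (Fin (n + n)) := fun j =>
    WithLp.toLp 2 (Fin.append (fun i => ⟪g (i : ℕ), U (e (j : ℕ))⟫_ℂ) (fun i => L i j))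
  have hx : Orthonormal ℂ x := by
    rw [orthonormal_iff_ite]
    intro i j
    have hPP : ∀ y z : H, ⟪PP g n y, z⟫_ℂ = ⟪y, PP g n z⟫_ℂ := by
      intro y z
      conv_lhs => rw [← PP_star, ContinuousLinearMap.adjoint_inner_left]
    have hidem : ∀ z : H, PP g n (PP g n z) = PP g n z := by
      intro z
      change iota g n (ContinuousLinearMap.adjoint (iota g n) (iota g n _)) = _
      rw [iota_adj_iota]; rfl
    have h1 : ⟪w i, w j⟫_ℂ = ⟪U (e i), U (e j)⟫_ℂ - ⟪U (e i), PP g n (U (e j))⟫_ℂ := by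
      simp only [w, inner_sub_left, inner_sub_right, hPP, hidem]
      abel
    have h2 : ⟪w i, w j⟫_ℂ = ∑ k, star (L k i) * L k j := by
      have := congrFun (congrFun hL i) j
      rw [Matrix.gram_apply, Matrix.mul_apply] at this
      simpa [Matrix.star_apply] using this
    have h3 : ⟪U (e i), U (e j)⟫_ℂ = if i = j then 1 else 0 := by
      rw [← ContinuousLinearMap.adjoint_inner_right, ← ContinuousLinearMap.star_eq_adjoint]
      have : (star U) (U (e j)) = e j := by
        have := congrArg (fun f : H →L[ℂ] H => f (e j)) ((Unitary.mem_iff.1 hU).1)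
        exact this
      rw [this, orthonormal_iff_ite.1 e.orthonormal]
      simp [Fin.val_inj]
    have h4 := inner_PP g n 1 (U (e i)) (U (e j))
    simp only [one_apply_eq_self] at h4
    have h5 : ⟪x i, x j⟫_ℂ = (∑ k : Fin n, ⟪U (e i), g k⟫_ℂ * ⟪g k, U (e j)⟫_ℂ)
        + ∑ k, star (L k i) * L k j := by
      rw [PiLp.inner_apply, Fin.sum_univ_add]
      simp only [x, Fin.append_left, Fin.append_right, RCLike.inner_apply, inner_conj_symm]
      congr 1 <;> exact Finset.sum_congr rfl fun k _ => mul_comm _ _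
    rw [h5, ← h2, h1, ← h4, h3]
    ring
  let v : Fin (n + n) → EuclideanSpace ℂ (Fin (n + n)) := Fin.append x (fun _ => 0)
  have hv : Orthonormal ℂ ((Set.range (Fin.castAdd n : Fin n → Fin (n + n))).domRestrict v) := by
    rw [orthonormal_iff_ite]
    rintro ⟨_, ⟨i, rfl⟩⟩ ⟨_, ⟨j, rfl⟩⟩
    have := orthonormal_iff_ite.1 hx i j
    have h0 : ∀ k, v (Fin.castAdd n k) = x k := fun k => by simp [v]
    simp only [Set.domRestrict_apply, h0, this]
    by_cases hij : i = j
    · subst hij; simp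
    · rw [if_neg hij, if_neg]
      intro h
      exact hij (Fin.castAdd_injective n n (Subtype.mk.inj h))
  obtain ⟨b, hb⟩ := hv.exists_orthonormalBasis_extension_of_card_eq (by simp)
  refine ⟨_, (EuclideanSpace.basisFun (Fin (n + n)) ℂ).toMatrix_orthonormalBasis_mem_unitary b, ?_⟩
  intro i j hi hj
  obtain ⟨i', rfl⟩ : ∃ i' : Fin n, i = Fin.castAdd n i' := ⟨⟨i, hi⟩, rfl⟩
  obtain ⟨j', rfl⟩ : ∃ j' : Fin n, j = Fin.castAdd n j' := ⟨⟨j, hj⟩, rfl⟩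
  have := hb (Fin.castAdd n j') ⟨j', rfl⟩
  simp [Module.Basis.toMatrix_apply, this, v, x]

lemma unitary_norm_le {U : H →L[ℂ] H} (hU : U ∈ unitary (H →L[ℂ] H)) : ‖U‖ ≤ 1 := by
  refine ContinuousLinearMap.opNorm_le_bound _ zero_le_one fun x => ?_
  rw [one_mul]
  exact (Unitary.norm_map ⟨U, hU⟩ x).le

end CNR

/-- For conjugate `p, q`, `C ∈ B^p(H)`, `T ∈ B^q(H)` and orthonormal bases
`e`, `g` of `H`, the matrix numerical ranges `W_{[C]ᵉ_{2n}}([T]ᵍ_{2n})` converge in the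
Hausdorff metric to the closure of `W_C(T)`. -/
theorem stmt_9 {H : Type*} [NormedAddCommGroup H] [InnerProductSpace ℂ H] [CompleteSpace H]
    (p q : ℝ≥0∞) (hpq : 1 / p + 1 / q = 1)
    (C T : H →L[ℂ] H) (hC : MemSchatten p C) (hT : MemSchatten q T)
    (e g : HilbertBasis ℕ ℂ H) :
    Tendsto (fun n : ℕ =>
        Metric.hausdorffDist (matNumRange (cutOut e (2 * n) C) (cutOut g (2 * n) T))
          (closure (cNumRange e C T)))
      atTop (nhds 0) := by
  have hp0 : p ≠ 0 := by rintro rfl; simp at hpq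
  have hq0 : q ≠ 0 := by rintro rfl; simp at hpq
  obtain ⟨c, hca, hc0, hc, hcs⟩ := schatten_seq hp0 hC
  obtain ⟨b, hba, hb0, hb, hbs⟩ := schatten_seq hq0 hT
  have hsum := summable_prod hpq hca hba hc0 hb0 hcs hbs
  simp only [Metric.hausdorffDist_closure₂]
  rw [Metric.tendsto_atTop]
  intro ε hε
  obtain ⟨N, hN⟩ := claim e g C T hC.1 hT.1 c b hca hba hsum hc hb (ε := ε / 6) (by positivity)
  have key : ∀ m ≥ N, ∀ U ∈ unitary (H →L[ℂ] H),
      ‖traceAlong e (C * star U * T * U) - Matrix.trace (cutOut e m C * star (corner e g m U)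
        * cutOut g m T * corner e g m U)‖ ≤ ε / 6 := by
    intro m hm U hU
    rw [← trace_eq]
    exact hN m hm _ _ (unitary_norm_le (Unitary.star_mem hU)) (unitary_norm_le hU)
  refine ⟨N, fun n hn => ?_⟩
  rw [Real.dist_eq, sub_zero, abs_of_nonneg Metric.hausdorffDist_nonneg]
  have h2n : 2 * n ≥ N := by omega
  refine lt_of_le_of_lt (b := ε / 2) ?_ (by linarith)
  refine Metric.hausdorffDist_le_of_mem_dist (by positivity) ?_ ?_
  · rintro z ⟨V, hV, rfl⟩
    obtain ⟨U, hU, hUV⟩ := exists_extension e g (2 * n) V hV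
    refine ⟨_, ⟨U, hU, rfl⟩, ?_⟩
    have := key _ h2n U hU
    rw [hUV] at this
    rw [dist_eq_norm, norm_sub_rev]
    linarith
  · rintro z ⟨U, hU, rfl⟩
    obtain ⟨V, hV, hVU⟩ := exists_dilation e g n (2 * n) (two_mul n) U hU
    obtain ⟨U', hU', hUV'⟩ := exists_extension e g (2 * n) V hV
    refine ⟨_, ⟨V, hV, rfl⟩, ?_⟩
    have k1 := key _ hn U hU
    have k2 := key _ hn U' hU'
    have k3 := key _ h2n U' hU'
    have hcor : corner e g n U' = corner e g n U := by
      ext i j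
      have hi : (i : ℕ) < 2 * n := by omega
      have hj : (j : ℕ) < 2 * n := by omega
      have a1 := hVU ⟨i, hi⟩ ⟨j, hj⟩ i.2 j.2
      have a2 := congrFun (congrFun hUV' ⟨i, hi⟩) ⟨j, hj⟩
      rw [a1] at a2
      exact a2
    rw [hcor] at k2
    rw [hUV'] at k3
    rw [norm_sub_rev] at k2
    rw [dist_eq_norm]
    refine (norm_sub_le_norm_sub_add_norm_sub _ (traceAlong e (C * star U' * T * U')) _).trans ?_
    have k4 := (norm_sub_le_norm_sub_add_norm_sub (traceAlong e (C * star U * T * U))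
      (Matrix.trace (cutOut e n C * star (corner e g n U) * cutOut g n T * corner e g n U))
      (traceAlong e (C * star U' * T * U')))
    linarith
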